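/- Fix a, b, c ∈ ℕ with n = a + b + c and strengths 0 < s_A < s_B < s_C satisfying s_A/s_B < 1/2 and s_B/s_C < 1/2. Let X_3(n) be the linear particle system on Ω_{a,b,c} and let X_t(n) be the Jump/Hop chain on the same state space Ω_{a,b,c} with the same strengths. Then there is a constant C, depending only on the ratios s_A/s_B and s_B/s_C, such that t(X_3(n)) ≤ C·n^4·t(X_t(n)). -/

import Mathlib

open Finset

/-- Total-variation mixing time: the least `T` such that for every starting state `x`
and every `t ≥ T`, the TV distance between `P^t(x, ·)` and `π` is at most `1/4`. -/
noncomputable def mixingTime {Ω : Type*} [Fintype Ω] [DecidableEq Ω]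
    (P : Matrix Ω Ω ℝ) (π : Ω → ℝ) : ℕ :=
  sInf {T : ℕ | ∀ x : Ω, ∀ t : ℕ, T ≤ t →
    (1 / 2) * ∑ y : Ω, |(P ^ t) x y - π y| ≤ 1 / 4}

/-- State space `Ω_{n₁,…,n_k}` of the linear particle system: words of length `n`
over `{1,…,k}` with exactly `cnt j` letters equal to `j`. -/
abbrev PSpace (n k : ℕ) (cnt : Fin k → ℕ) : Type :=
  {w : Fin n → Fin k // ∀ j : Fin k, (Finset.univ.filter fun i => w i = j).card = cnt j}

/-- Transition matrix of the linear particle system `X_k(n)`: from state `v`, a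
position `i` with `i+1 < n` is chosen uniformly; if the two letters are equal nothing
happens, otherwise they are swapped with probability `s(v i)/(s(v i)+s(v (i+1)))`. -/
noncomputable def partP (n k : ℕ) (cnt : Fin k → ℕ) (s : Fin k → ℝ) :
    Matrix (PSpace n k cnt) (PSpace n k cnt) ℝ :=
  fun v u => (1 / ((n : ℝ) - 1)) * ∑ i : Fin n, ∑ j : Fin n,
    if (j : ℕ) = (i : ℕ) + 1 then
      if v.1 i = v.1 j then (if u = v then 1 else 0)
      else
        (s (v.1 i) / (s (v.1 i) + s (v.1 j))) *
          (if u.1 = v.1 ∘ Equiv.swap i j then 1 else 0)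
        + (s (v.1 j) / (s (v.1 i) + s (v.1 j))) *
          (if u = v then 1 else 0)
    else 0

/-- Unnormalized stationary weight of the linear particle system:
`w(v) = ∏_i s(v i)^i` (positions counted `1,…,n`). -/
noncomputable def partW (n k : ℕ) (cnt : Fin k → ℕ) (s : Fin k → ℝ)
    (v : PSpace n k cnt) : ℝ :=
  ∏ i : Fin n, s (v.1 i) ^ ((i : ℕ) + 1)

/-- Stationary distribution of the linear particle system. -/
noncomputable def partPi (n k : ℕ) (cnt : Fin k → ℕ) (s : Fin k → ℝ)
    (v : PSpace n k cnt) : ℝ :=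
  partW n k cnt s v / ∑ u : PSpace n k cnt, partW n k cnt s u

/-- Transition matrix of the Jump/Hop chain `X_t(n)` on `Ω_{a,b,c}`; letters of the
alphabet `Fin 3` are `0 = A`, `1 = B`, `2 = C`.  A pair of positions `i < j` is chosen
uniformly at random and a Jump or Hop move is performed when its preconditions hold. -/
noncomputable def jumpP (a b c : ℕ) (sA sB sC : ℝ) :
    Matrix (PSpace (a + b + c) 3 ![a, b, c]) (PSpace (a + b + c) 3 ![a, b, c]) ℝ :=
  fun v u =>
    (1 / ((a + b + c).choose 2 : ℝ)) *
      ∑ i : Fin (a + b + c), ∑ j : Fin (a + b + c),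
        if i < j then
          if ((v.1 i = 0 ∧ v.1 j = 2) ∨ (v.1 i = 2 ∧ v.1 j = 0)) ∧
              (∀ l, i < l → l < j → v.1 l = 1) then
            -- Jump
            ((sC / sA) ^ ((j : ℕ) - (i : ℕ)) / (1 + (sC / sA) ^ ((j : ℕ) - (i : ℕ)))) *
              (if u.1 = (fun x => if x = i then (0 : Fin 3) else if x = j then 2 else v.1 x)
                then 1 else 0)
            + (1 / (1 + (sC / sA) ^ ((j : ℕ) - (i : ℕ)))) *
              (if u.1 = (fun x => if x = i then (2 : Fin 3) else if x = j then 0 else v.1 x)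
                then 1 else 0)
          else if (v.1 i = 0 ∧ ∀ l, i < l → l ≤ j → v.1 l = 1) ∨
                  (v.1 j = 0 ∧ ∀ l, i ≤ l → l < j → v.1 l = 1) then
            -- Hop, A–B case
            ((sB / sA) ^ ((j : ℕ) - (i : ℕ)) / (1 + (sB / sA) ^ ((j : ℕ) - (i : ℕ)))) *
              (if u.1 = (fun x => if x = i then (0 : Fin 3)
                  else if i ≤ x ∧ x ≤ j then 1 else v.1 x) then 1 else 0)
            + (1 / (1 + (sB / sA) ^ ((j : ℕ) - (i : ℕ)))) *
              (if u.1 = (fun x => if x = j then (0 : Fin 3)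
                  else if i ≤ x ∧ x ≤ j then 1 else v.1 x) then 1 else 0)
          else if (v.1 i = 2 ∧ ∀ l, i < l → l ≤ j → v.1 l = 1) ∨
                  (v.1 j = 2 ∧ ∀ l, i ≤ l → l < j → v.1 l = 1) then
            -- Hop, B–C case
            ((sC / sB) ^ ((j : ℕ) - (i : ℕ)) / (1 + (sC / sB) ^ ((j : ℕ) - (i : ℕ)))) *
              (if u.1 = (fun x => if x = j then (2 : Fin 3)
                  else if i ≤ x ∧ x ≤ j then 1 else v.1 x) then 1 else 0)
            + (1 / (1 + (sC / sB) ^ ((j : ℕ) - (i : ℕ)))) *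
              (if u.1 = (fun x => if x = i then (2 : Fin 3)
                  else if i ≤ x ∧ x ≤ j then 1 else v.1 x) then 1 else 0)
          else (if u = v then 1 else 0)
        else 0

/-- `P` is a stochastic matrix in detailed balance with the positive distribution `π`. -/
structure ReversibleChain {Ω : Type*} [Fintype Ω] (P : Matrix Ω Ω ℝ) (π : Ω → ℝ) : Prop where
  pi_pos : ∀ x, 0 < π x
  pi_sum : ∑ x, π x = 1
  nonneg : ∀ x y, 0 ≤ P x y
  row_sum : ∀ x, ∑ y, P x y = 1
  balance : ∀ x y, π x * P x y = π y * P y x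

/-- Twice the Dirichlet form of the chain `P` with stationary distribution `π`. -/
def dirichletSum {Ω : Type*} [Fintype Ω] (P : Matrix Ω Ω ℝ) (π f : Ω → ℝ) : ℝ :=
  ∑ x, ∑ y, π x * P x y * (f x - f y) ^ 2

/-- The squared norm of `f` in `L²(π)`. -/
def sqNorm {Ω : Type*} [Fintype Ω] (π f : Ω → ℝ) : ℝ :=
  ∑ x, π x * f x ^ 2

namespace ReversibleChain

open scoped Matrix

variable {Ω : Type*} [Fintype Ω] {P : Matrix Ω Ω ℝ} {π : Ω → ℝ}

lemma sqNorm_nonneg (h : ReversibleChain P π) (f : Ω → ℝ) : 0 ≤ sqNorm π f :=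
  Finset.sum_nonneg fun x _ => mul_nonneg (h.pi_pos x).le (sq_nonneg _)

lemma inner_mulVec (h : ReversibleChain P π) (f g : Ω → ℝ) :
    ∑ x, π x * g x * (P *ᵥ f) x = ∑ x, π x * (P *ᵥ g) x * f x := by
  simp only [Matrix.mulVec, dotProduct, Finset.mul_sum, Finset.sum_mul]
  rw [Finset.sum_comm]
  refine Finset.sum_congr rfl fun y _ => Finset.sum_congr rfl fun x _ => ?_
  linear_combination g x * f y * h.balance x y

lemma mean_mulVec (h : ReversibleChain P π) (f : Ω → ℝ) :
    ∑ x, π x * (P *ᵥ f) x = ∑ x, π x * f x := by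
  have := h.inner_mulVec f (fun _ => 1)
  simpa [Matrix.mulVec, dotProduct, h.row_sum] using this

lemma dirichletSum_eq (h : ReversibleChain P π) (f : Ω → ℝ) :
    dirichletSum P π f = 2 * (sqNorm π f - ∑ x, π x * f x * (P *ᵥ f) x) := by
  have h1 : ∑ x, ∑ y, π x * P x y * f x ^ 2 = sqNorm π f := by
    refine Finset.sum_congr rfl fun x _ => ?_
    rw [← Finset.sum_mul, ← Finset.mul_sum, h.row_sum, mul_one]
  have h2 : ∑ x, ∑ y, π x * P x y * f y ^ 2 = sqNorm π f := by
    rw [← h1, Finset.sum_comm]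
    refine Finset.sum_congr rfl fun x _ => Finset.sum_congr rfl fun y _ => ?_
    rw [h.balance]
  have h3 : ∑ x, ∑ y, π x * P x y * (f x * f y) = ∑ x, π x * f x * (P *ᵥ f) x := by
    refine Finset.sum_congr rfl fun x _ => ?_
    simp only [Matrix.mulVec, dotProduct, Finset.mul_sum]
    exact Finset.sum_congr rfl fun y _ => by ring
  have h4 : dirichletSum P π f = ∑ x, ∑ y, π x * P x y * f x ^ 2
      + ∑ x, ∑ y, π x * P x y * f y ^ 2 - 2 * ∑ x, ∑ y, π x * P x y * (f x * f y) := by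
    simp only [dirichletSum, Finset.mul_sum, ← Finset.sum_add_distrib, ← Finset.sum_sub_distrib]
    exact Finset.sum_congr rfl fun x _ => Finset.sum_congr rfl fun y _ => by ring
  rw [h4, h1, h2, h3]
  ring

lemma mul_self (h : ReversibleChain P π) : ReversibleChain (P * P) π where
  pi_pos := h.pi_pos
  pi_sum := h.pi_sum
  nonneg x y := by
    rw [Matrix.mul_apply]
    exact Finset.sum_nonneg fun z _ => mul_nonneg (h.nonneg _ _) (h.nonneg _ _)
  row_sum x := by
    simp only [Matrix.mul_apply]
    rw [Finset.sum_comm]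
    simp [← Finset.mul_sum, h.row_sum]
  balance x y := by
    simp only [Matrix.mul_apply, Finset.mul_sum]
    refine Finset.sum_congr rfl fun z _ => ?_
    linear_combination P z y * h.balance x z + P z x * h.balance z y

lemma sqNorm_mulVec (h : ReversibleChain P π) (f : Ω → ℝ) :
    sqNorm π (P *ᵥ f) = sqNorm π f - dirichletSum (P * P) π f / 2 := by
  have h1 := h.inner_mulVec (P *ᵥ f) f
  rw [h.mul_self.dirichletSum_eq, ← Matrix.mulVec_mulVec, h1]
  have : sqNorm π (P *ᵥ f) = ∑ x, π x * (P *ᵥ f) x * (P *ᵥ f) x :=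
    Finset.sum_congr rfl fun x _ => by ring
  rw [this]
  ring

/-- A chain with holding probabilities at least `δ` contracts the norm at a rate controlled
by its Dirichlet form. -/
lemma sqNorm_mulVec_le (h : ReversibleChain P π) {δ : ℝ} (hδ : ∀ x, δ ≤ P x x) (f : Ω → ℝ) :
    sqNorm π (P *ᵥ f) ≤ sqNorm π f - δ / 2 * dirichletSum P π f := by
  rw [h.sqNorm_mulVec]
  suffices δ * dirichletSum P π f ≤ dirichletSum (P * P) π f by linarith
  simp only [dirichletSum, Finset.mul_sum]
  refine Finset.sum_le_sum fun x _ => Finset.sum_le_sum fun y _ => ?_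
  have h1 : δ * P x y ≤ (P * P) x y := by
    rw [Matrix.mul_apply]
    calc δ * P x y ≤ P x x * P x y := mul_le_mul_of_nonneg_right (hδ x) (h.nonneg x y)
      _ ≤ _ := Finset.single_le_sum (f := fun z => P x z * P z y)
        (fun z _ => mul_nonneg (h.nonneg _ _) (h.nonneg _ _)) (Finset.mem_univ x)
  have h2 := mul_le_mul_of_nonneg_left h1 (mul_nonneg (h.pi_pos x).le (sq_nonneg (f x - f y)))
  linarith

lemma sqNorm_sub_sqNorm_mulVec_le (h : ReversibleChain P π) (f : Ω → ℝ) :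
    sqNorm π f - sqNorm π (P *ᵥ f) ≤ dirichletSum P π f := by
  have h1 : 0 ≤ ∑ x, π x * (f x - (P *ᵥ f) x) ^ 2 :=
    Finset.sum_nonneg fun x _ => mul_nonneg (h.pi_pos x).le (sq_nonneg _)
  have h2 : ∑ x, π x * (f x - (P *ᵥ f) x) ^ 2
      = sqNorm π f + sqNorm π (P *ᵥ f) - 2 * ∑ x, π x * f x * (P *ᵥ f) x := by
    simp only [sqNorm, Finset.mul_sum, ← Finset.sum_add_distrib, ← Finset.sum_sub_distrib]
    exact Finset.sum_congr rfl fun x _ => by ring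
  rw [h.dirichletSum_eq]
  linarith

lemma two_mul_sqNorm_mulVec_le (h : ReversibleChain P π) (f : Ω → ℝ) :
    2 * sqNorm π (P *ᵥ f) ≤ sqNorm π f + sqNorm π (P *ᵥ (P *ᵥ f)) := by
  have h1 := h.inner_mulVec (P *ᵥ f) f
  have h2 : sqNorm π (P *ᵥ f) = ∑ x, π x * f x * (P *ᵥ (P *ᵥ f)) x := by
    rw [h1]
    exact Finset.sum_congr rfl fun x _ => by ring
  rw [h2]
  simp only [sqNorm, Finset.mul_sum, ← Finset.sum_add_distrib]
  refine Finset.sum_le_sum fun x _ => ?_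
  nlinarith [mul_nonneg (h.pi_pos x).le (sq_nonneg (f x - (P *ᵥ (P *ᵥ f)) x))]

variable [DecidableEq Ω]

lemma pow (h : ReversibleChain P π) (t : ℕ) : ReversibleChain (P ^ t) π := by
  induction t with
  | zero =>
    refine ⟨h.pi_pos, h.pi_sum, fun x y => ?_, fun x => ?_, fun x y => ?_⟩
    · rw [pow_zero, Matrix.one_apply]; positivity
    · simp [Matrix.one_apply]
    · by_cases hxy : x = y
      · simp [hxy]
      · simp [hxy, Ne.symm hxy]
  | succ t ih =>
    refine ⟨h.pi_pos, h.pi_sum, fun x y => ?_, fun x => ?_, fun x y => ?_⟩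
    · rw [pow_succ, Matrix.mul_apply]
      exact Finset.sum_nonneg fun z _ => mul_nonneg (ih.nonneg _ _) (h.nonneg _ _)
    · simp only [pow_succ, Matrix.mul_apply]
      rw [Finset.sum_comm]
      simp [← Finset.mul_sum, h.row_sum, ih.row_sum]
    · rw [pow_succ, Matrix.mul_apply, ← pow_succ, pow_succ', Matrix.mul_apply]
      simp only [Finset.mul_sum]
      refine Finset.sum_congr rfl fun z _ => ?_
      linear_combination P z y * ih.balance x z + (P ^ t) z x * h.balance z y

lemma sqNorm_sub_sqNorm_pow_le (h : ReversibleChain P π) (f : Ω → ℝ) (t : ℕ) :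
    sqNorm π f - sqNorm π (P ^ t *ᵥ f) ≤ t * dirichletSum P π f := by
  have step : ∀ t : ℕ, sqNorm π (P ^ t *ᵥ f) - sqNorm π (P ^ (t + 1) *ᵥ f)
      ≤ dirichletSum P π f := by
    intro t
    induction t with
    | zero => simpa using h.sqNorm_sub_sqNorm_mulVec_le f
    | succ t ih =>
      have := h.two_mul_sqNorm_mulVec_le (P ^ t *ᵥ f)
      simp only [Matrix.mulVec_mulVec, ← pow_succ'] at this
      linarith
  induction t with
  | zero => simp
  | succ t ih =>
    have := step t
    push_cast
    linarith

/-- A total variation mixing bound yields a Poincaré inequality. -/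
lemma sqNorm_le_of_mixed (h : ReversibleChain P π) {T : ℕ}
    (hT : ∀ x : Ω, ∀ t : ℕ, T ≤ t → (1 / 2) * ∑ y : Ω, |(P ^ t) x y - π y| ≤ 1 / 4)
    {f : Ω → ℝ} (hf : ∑ x, π x * f x = 0) :
    sqNorm π f ≤ 2 * T * dirichletSum P π f := by
  have h0 := h.sqNorm_sub_sqNorm_pow_le f T
  suffices sqNorm π (P ^ T *ᵥ f) ≤ 1 / 2 * sqNorm π f by linarith
  have hP := h.pow (T + T)
  set R : Ω → Ω → ℝ := fun x y => (P ^ (T + T)) x y - π y with hR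
  have hsymm : ∀ x y, π x * |R x y| = π y * |R y x| := by
    intro x y
    have h1 : π x * R x y = π y * R y x := by
      simp only [hR]
      linear_combination hP.balance x y
    have h2 := congrArg (|·|) h1
    simpa only [abs_mul, abs_of_pos (h.pi_pos _)] using h2
  have h1 : sqNorm π (P ^ T *ᵥ f) = ∑ x, ∑ y, π x * R x y * (f x * f y) := by
    have h2 := (h.pow T).inner_mulVec (P ^ T *ᵥ f) f
    have h3 : sqNorm π (P ^ T *ᵥ f) = ∑ x, π x * f x * (P ^ (T + T) *ᵥ f) x := by
      rw [pow_add, ← Matrix.mulVec_mulVec, h2]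
      exact Finset.sum_congr rfl fun x _ => by ring
    rw [h3]
    refine Finset.sum_congr rfl fun x _ => ?_
    have h4 : ∑ y, π x * f x * (π y * f y) = 0 := by
      rw [← Finset.mul_sum, hf, mul_zero]
    rw [← sub_zero (π x * f x * _), ← h4, Matrix.mulVec, dotProduct, Finset.mul_sum,
      ← Finset.sum_sub_distrib]
    exact Finset.sum_congr rfl fun y _ => by simp only [hR]; ring
  have h5 : ∑ x, ∑ y, π x * |R x y| * f y ^ 2 = ∑ x, ∑ y, π x * |R x y| * f x ^ 2 := by
    rw [Finset.sum_comm]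
    exact Finset.sum_congr rfl fun x _ => Finset.sum_congr rfl fun y _ => by rw [hsymm]
  calc sqNorm π (P ^ T *ᵥ f)
      ≤ ∑ x, ∑ y, (π x * |R x y| * f x ^ 2 / 2 + π x * |R x y| * f y ^ 2 / 2) := by
        rw [h1]
        refine Finset.sum_le_sum fun x _ => Finset.sum_le_sum fun y _ => ?_
        have h6 : R x y * (f x * f y) ≤ |R x y| * ((f x ^ 2 + f y ^ 2) / 2) := by
          refine (le_abs_self _).trans ?_
          rw [abs_mul]
          refine mul_le_mul_of_nonneg_left ?_ (abs_nonneg _)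
          rw [abs_le]
          constructor <;> nlinarith [sq_nonneg (f x + f y), sq_nonneg (f x - f y)]
        have := mul_le_mul_of_nonneg_left h6 (h.pi_pos x).le
        linarith
    _ = ∑ x, ∑ y, π x * |R x y| * f x ^ 2 := by
        simp only [Finset.sum_add_distrib, ← Finset.sum_div]
        rw [h5]
        ring
    _ ≤ ∑ x, 1 / 2 * (π x * f x ^ 2) := by
        refine Finset.sum_le_sum fun x _ => ?_
        have h7 := hT x (T + T) (by omega)
        have h8 : ∑ y, π x * |R x y| * f x ^ 2 = (π x * f x ^ 2) * ∑ y, |R x y| := by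
          rw [Finset.mul_sum]
          exact Finset.sum_congr rfl fun y _ => by ring
        rw [h8]
        have h9 : ∑ y, |R x y| ≤ 1 / 2 := by simp only [hR]; linarith
        have := mul_le_mul_of_nonneg_left h9 (mul_nonneg (h.pi_pos x).le (sq_nonneg (f x)))
        linarith
    _ = 1 / 2 * sqNorm π f := by rw [sqNorm, Finset.mul_sum]

/-- Norm contraction by the factor `p / 4` on mean zero functions, where `p` bounds `π` from
below, forces total variation distance at most `1 / 4`. -/
lemma mixed_of_contraction (h : ReversibleChain P π) {p : ℝ} (hp : ∀ x, p ≤ π x) (hp0 : 0 < p)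
    (t : ℕ) (hc : ∀ f : Ω → ℝ, ∑ x, π x * f x = 0 →
      sqNorm π (P ^ t *ᵥ f) ≤ p / 4 * sqNorm π f) (x : Ω) :
    (1 / 2) * ∑ y : Ω, |(P ^ t) x y - π y| ≤ 1 / 4 := by
  have hP := h.pow t
  set σ : Ω → ℝ := fun y => if 0 ≤ (P ^ t) x y - π y then 1 else -1 with hσ
  set m : ℝ := ∑ y, π y * σ y with hm
  have hσ2 : ∀ y, σ y ^ 2 = 1 := fun y => by simp only [hσ]; split_ifs <;> norm_num
  have hmean : ∑ y, π y * (σ y - m) = 0 := by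
    simp only [mul_sub, Finset.sum_sub_distrib, ← Finset.sum_mul, h.pi_sum]
    rw [← hm]
    ring
  have hnorm : sqNorm π (fun y => σ y - m) ≤ 1 := by
    have : sqNorm π (fun y => σ y - m) = ∑ y, π y - 2 * m * m + m ^ 2 * ∑ y, π y := by
      rw [sqNorm]
      nth_rewrite 3 [hm]
      simp only [Finset.mul_sum, ← Finset.sum_add_distrib, ← Finset.sum_sub_distrib]
      exact Finset.sum_congr rfl fun y _ => by linear_combination π y * hσ2 y
    rw [this, h.pi_sum]
    nlinarith [sq_nonneg m]
  have hval : (P ^ t *ᵥ fun y => σ y - m) x = ∑ y, |(P ^ t) x y - π y| := by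
    simp only [Matrix.mulVec, dotProduct, mul_sub, Finset.sum_sub_distrib, ← Finset.sum_mul,
      hP.row_sum]
    rw [one_mul, hm, ← Finset.sum_sub_distrib]
    refine Finset.sum_congr rfl fun y _ => ?_
    simp only [hσ]
    split_ifs with h0
    · rw [abs_of_nonneg h0]; ring
    · rw [abs_of_neg (not_le.mp h0)]; ring
  have h1 := hc _ hmean
  have h2 : π x * (P ^ t *ᵥ fun y => σ y - m) x ^ 2 ≤ sqNorm π (P ^ t *ᵥ fun y => σ y - m) :=
    Finset.single_le_sum (f := fun z => π z * (P ^ t *ᵥ fun y => σ y - m) z ^ 2)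
      (fun z _ => mul_nonneg (h.pi_pos z).le (sq_nonneg _)) (Finset.mem_univ x)
  rw [hval] at h2
  set s := ∑ y, |(P ^ t) x y - π y|
  have h3 : p * s ^ 2 ≤ p * (1 / 4) := by
    have := mul_le_mul_of_nonneg_right (hp x) (sq_nonneg s)
    nlinarith
  have h4 : s ^ 2 ≤ 1 / 4 := le_of_mul_le_mul_left h3 hp0
  nlinarith

/-- A Poincaré inequality with constant `K` together with holding probabilities at least `δ`
bounds the total variation distance after `(2 * K / δ) * log (4 / min π)` steps. -/
lemma mixed_of_poincare (h : ReversibleChain P π) {p δ K : ℝ} (hp : ∀ x, p ≤ π x) (hp0 : 0 < p)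
    (hδ : ∀ x, δ ≤ P x x) (hδ0 : 0 < δ) (hK0 : 0 ≤ K)
    (hK : ∀ f : Ω → ℝ, ∑ x, π x * f x = 0 → sqNorm π f ≤ K * dirichletSum P π f)
    (t : ℕ) (ht : 2 * K / δ * Real.log (4 / p) ≤ t) (x : Ω) :
    (1 / 2) * ∑ y : Ω, |(P ^ t) x y - π y| ≤ 1 / 4 := by
  refine h.mixed_of_contraction hp hp0 t (fun f hf => ?_) x
  have hmean : ∀ t : ℕ, ∑ x, π x * (P ^ t *ᵥ f) x = 0 := fun t => by
    rw [(h.pow t).mean_mulVec, hf]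
  rcases hK0.eq_or_lt with rfl | hKpos
  · have h1 := hK _ (hmean t)
    have h2 := h.sqNorm_nonneg f
    rw [zero_mul] at h1
    exact h1.trans (mul_nonneg (by positivity) h2)
  have hstep : ∀ g : Ω → ℝ, ∑ x, π x * g x = 0 →
      sqNorm π (P *ᵥ g) ≤ Real.exp (-(δ / (2 * K))) * sqNorm π g := by
    intro g hg
    have h1 := h.sqNorm_mulVec_le hδ g
    have h2 : δ / (2 * K) * sqNorm π g ≤ δ / 2 * dirichletSum P π g := by
      calc δ / (2 * K) * sqNorm π g ≤ δ / (2 * K) * (K * dirichletSum P π g) :=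
            mul_le_mul_of_nonneg_left (hK g hg) (by positivity)
        _ = _ := by field_simp
    have h3 := mul_le_mul_of_nonneg_right (Real.add_one_le_exp (-(δ / (2 * K))))
      (h.sqNorm_nonneg g)
    linarith
  have hpow : ∀ t : ℕ, sqNorm π (P ^ t *ᵥ f) ≤ Real.exp (-(δ / (2 * K))) ^ t * sqNorm π f := by
    intro t
    induction t with
    | zero => simp
    | succ t ih =>
      have h1 := hstep _ (hmean t)
      rw [Matrix.mulVec_mulVec, ← pow_succ'] at h1
      refine h1.trans ?_
      rw [pow_succ', mul_assoc]
      exact mul_le_mul_of_nonneg_left ih (Real.exp_pos _).le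
  refine (hpow t).trans (mul_le_mul_of_nonneg_right ?_ (h.sqNorm_nonneg f))
  rw [← Real.exp_nat_mul, ← Real.le_log_iff_exp_le (by positivity)]
  have h1 : Real.log (4 / p) ≤ t * (δ / (2 * K)) := by
    calc Real.log (4 / p) = 2 * K / δ * Real.log (4 / p) * (δ / (2 * K)) := by field_simp
      _ ≤ _ := mul_le_mul_of_nonneg_right ht (by positivity)
  have h2 : Real.log (p / 4) = -Real.log (4 / p) := by
    rw [← Real.log_inv, inv_div]
  rw [h2]
  linarith

end ReversibleChain

section HeatBath

variable {Ω E : Type*} [DecidableEq Ω]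

/-- Resample the state among `v` and `τ v` with probabilities proportional to `π`. -/
noncomputable def hbKernel (π : Ω → ℝ) (τ : Ω → Ω) (v u : Ω) : ℝ :=
  (π v * (if u = v then 1 else 0) + π (τ v) * (if u = τ v then 1 else 0)) / (π v + π (τ v))

/-- The heat-bath chain that picks `e ∈ S` uniformly and resamples along `τ e`. -/
noncomputable def heatBath (π : Ω → ℝ) (S : Finset E) (τ : E → Ω → Ω) : Matrix Ω Ω ℝ :=
  fun v u => (1 / (#S : ℝ)) * ∑ e ∈ S, hbKernel π (τ e) v u

lemma hbKernel_eq_of_fixed {π : Ω → ℝ} (hπ : ∀ v, 0 < π v) {τ : Ω → Ω} {v : Ω} (h : τ v = v)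
    (u : Ω) : hbKernel π τ v u = if u = v then 1 else 0 := by
  have := hπ v
  rw [hbKernel, h]
  field_simp

lemma le_heatBath_self {π : Ω → ℝ} (hπ : ∀ v, 0 < π v) {S : Finset E} (hS : S.Nonempty)
    {τ : E → Ω → Ω} {δ : ℝ} (v : Ω) (hδ : ∀ e ∈ S, δ ≤ π v / (π v + π (τ e v))) :
    δ ≤ heatBath π S τ v v := by
  have hcard : (0 : ℝ) < #S := by exact_mod_cast hS.card_pos
  have h1 : #S * δ ≤ ∑ e ∈ S, hbKernel π (τ e) v v := by
    rw [← nsmul_eq_mul]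
    refine Finset.card_nsmul_le_sum _ _ _ fun e he => (hδ e he).trans ?_
    have h2 := (hπ (τ e v)).le
    have h3 := hπ v
    simp only [hbKernel, if_true, mul_one]
    gcongr
    exact le_add_of_nonneg_right (by positivity)
  rw [heatBath]
  calc δ = (1 / (#S : ℝ)) * (#S * δ) := by field_simp
    _ ≤ _ := mul_le_mul_of_nonneg_left h1 (by positivity)

variable [Fintype Ω]

/-- The Dirichlet sum of a single heat-bath update. -/
noncomputable def edgeEnergy (π : Ω → ℝ) (τ : Ω → Ω) (f : Ω → ℝ) : ℝ :=
  ∑ v, π v * π (τ v) / (π v + π (τ v)) * (f v - f (τ v)) ^ 2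

lemma heatBath_reversible {π : Ω → ℝ} (hπ : ∀ v, 0 < π v) (hsum : ∑ v, π v = 1)
    {S : Finset E} (hS : S.Nonempty) {τ : E → Ω → Ω}
    (hτ : ∀ e ∈ S, Function.Involutive (τ e)) : ReversibleChain (heatBath π S τ) π := by
  have hcard : (0 : ℝ) < #S := by exact_mod_cast hS.card_pos
  have hden : ∀ v u, 0 < π v + π u := fun v u => add_pos (hπ v) (hπ u)
  refine ⟨hπ, hsum, fun v u => ?_, fun v => ?_, fun v u => ?_⟩
  · refine mul_nonneg (by positivity) (Finset.sum_nonneg fun e _ => ?_)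
    have h1 := (hπ v).le
    have h2 := (hπ (τ e v)).le
    unfold hbKernel
    positivity
  · simp only [heatBath]
    rw [← Finset.mul_sum, Finset.sum_comm]
    have : ∀ e ∈ S, ∑ u, hbKernel π (τ e) v u = 1 := fun e _ => by
      simp only [hbKernel]
      rw [← Finset.sum_div, Finset.sum_add_distrib]
      simp [(hden v (τ e v)).ne']
    rw [Finset.sum_congr rfl this]
    simp [hcard.ne']
  · simp only [heatBath]
    rw [mul_left_comm, mul_left_comm (π u), Finset.mul_sum _ _ (π v), Finset.mul_sum _ _ (π u)]
    congr 1
    refine Finset.sum_congr rfl fun e he => ?_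
    simp only [hbKernel]
    by_cases h1 : u = v
    · rw [h1]
    · by_cases h2 : u = τ e v
      · have h3 : v = τ e u := by rw [h2, hτ e he]
        rw [← h2, ← h3]
        simp only [h1, Ne.symm h1, if_true, if_false]
        rw [add_comm (π u) (π v)]
        ring
      · have h3 : v ≠ τ e u := fun h => h2 (by rw [h, hτ e he])
        simp [h1, Ne.symm h1, h2, h3]

lemma dirichletSum_heatBath (π : Ω → ℝ) (S : Finset E) (τ : E → Ω → Ω) (f : Ω → ℝ) :
    dirichletSum (heatBath π S τ) π f = (1 / (#S : ℝ)) * ∑ e ∈ S, edgeEnergy π (τ e) f := by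
  have h1 : ∀ e v, ∑ u, π v * hbKernel π (τ e) v u * (f v - f u) ^ 2
      = π v * π (τ e v) / (π v + π (τ e v)) * (f v - f (τ e v)) ^ 2 := by
    intro e v
    rw [← Finset.sum_subset (Finset.subset_univ {τ e v})]
    · rw [Finset.sum_singleton, hbKernel]
      by_cases h : τ e v = v
      · simp [h]
      · simp only [h, if_true, if_false]
        ring
    · intro u _ hu
      rw [Finset.mem_singleton] at hu
      by_cases h : u = v
      · simp [h]
      · simp [hbKernel, h, hu]
  simp only [dirichletSum, heatBath, edgeEnergy, ← h1]
  rw [Finset.sum_comm (s := S), Finset.mul_sum]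
  refine Finset.sum_congr rfl fun v _ => ?_
  rw [Finset.sum_comm, Finset.mul_sum]
  refine Finset.sum_congr rfl fun u _ => ?_
  simp only [Finset.mul_sum, Finset.sum_mul]
  exact Finset.sum_congr rfl fun e _ => by ring

lemma mul_div_add_le_right {a b : ℝ} (ha : 0 < a) (hb : 0 < b) : a * b / (a + b) ≤ b := by
  rw [div_le_iff₀ (by positivity)]
  nlinarith

lemma le_two_mul_mul_div_add {a b : ℝ} (ha : 0 < a) (hb : 0 < b) (hab : b ≤ a) :
    b ≤ 2 * (a * b / (a + b)) := by
  rw [← mul_div_assoc, le_div_iff₀ (by positivity)]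
  nlinarith

lemma sq_add_add_le {L : ℝ} (hL : 0 < L) (a b c : ℝ) :
    (a + b + c) ^ 2 ≤ (L + 2) * (a ^ 2 + 1 / L * b ^ 2 + c ^ 2) := by
  have h : (L + 2) * (a ^ 2 + 1 / L * b ^ 2 + c ^ 2) - (a + b + c) ^ 2
      = ((b - L * a) ^ 2 + (b - L * c) ^ 2) / L + (a - c) ^ 2 := by
    field_simp
    ring
  have : 0 ≤ ((b - L * a) ^ 2 + (b - L * c) ^ 2) / L + (a - c) ^ 2 := by positivity
  linarith

end HeatBath

section Words

variable {n k : ℕ} {cnt : Fin k → ℕ}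

/-- Exchange of the letters at two positions. -/
def swapPos (i j : Fin n) (v : PSpace n k cnt) : PSpace n k cnt :=
  ⟨v.1 ∘ Equiv.swap i j, fun l => by
    rw [← v.2 l]
    exact Finset.card_equiv (Equiv.swap i j) (by simp)⟩

@[simp] lemma swapPos_val (i j : Fin n) (v : PSpace n k cnt) (x : Fin n) :
    (swapPos i j v).1 x = v.1 (Equiv.swap i j x) := rfl

lemma eq_swapPos_iff {i j : Fin n} {u v : PSpace n k cnt} :
    u = swapPos i j v ↔ u.1 = v.1 ∘ Equiv.swap i j := Subtype.ext_iff

lemma swapPos_involutive (i j : Fin n) :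
    Function.Involutive (swapPos i j : PSpace n k cnt → PSpace n k cnt) := fun v =>
  Subtype.ext (funext fun x => by simp)

lemma swapPos_eq_self {i j : Fin n} {v : PSpace n k cnt} (h : v.1 i = v.1 j) :
    swapPos i j v = v := by
  refine Subtype.ext (funext fun x => ?_)
  rw [swapPos_val, Equiv.swap_apply_def]
  split_ifs with h1 h2
  · rw [h1, h]
  · rw [h2, h]
  · rfl

lemma sum_swapPos (i j : Fin n) (g : PSpace n k cnt → ℝ) :
    ∑ v, g (swapPos i j v) = ∑ v, g v :=
  Equiv.sum_comp (swapPos_involutive i j).toPerm g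

lemma swapPos_conj {i m j : Fin n} (hmj : m ≠ j) (hij : i ≠ j) (v : PSpace n k cnt) :
    swapPos i m (swapPos m j (swapPos i m v)) = swapPos i j v := by
  refine Subtype.ext (funext fun x => ?_)
  have h := Equiv.swap_mul_swap_mul_swap hmj.symm hij.symm
  rw [Equiv.swap_comm m i, Equiv.swap_comm j m] at h
  simp only [swapPos_val, ← h, Equiv.Perm.mul_apply]

/-- The pairs of adjacent positions. -/
def adjPairs (n : ℕ) : Finset (Fin n × Fin n) :=
  Finset.univ.filter fun p => (p.2 : ℕ) = p.1 + 1

/-- The pairs of distinct positions, in increasing order. -/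
def ltPairs (n : ℕ) : Finset (Fin n × Fin n) :=
  Finset.univ.filter fun p => p.1 < p.2

lemma card_adjPairs (n : ℕ) : #(adjPairs (n + 1)) = n := by
  have : adjPairs (n + 1) = Finset.univ.map
      ⟨fun i : Fin n => (i.castSucc, i.succ), fun i j h => by simpa using h⟩ := by
    ext ⟨p, q⟩
    simp only [adjPairs, Finset.mem_filter, Finset.mem_univ, true_and, Finset.mem_map]
    constructor
    · intro h
      exact ⟨⟨p, by omega⟩, Prod.ext rfl (Fin.ext h.symm)⟩
    · rintro ⟨i, hi⟩
      cases hi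
      simp
  rw [this, Finset.card_map, Finset.card_univ, Fintype.card_fin]

lemma card_ltPairs (n : ℕ) : #(ltPairs n) = n.choose 2 := by
  rw [ltPairs, Finset.card_filter, Fintype.sum_prod_type_right]
  simp only [← Finset.card_filter, Finset.filter_gt_eq_Iio, Fin.card_Iio]
  rw [Fin.sum_univ_eq_sum_range (fun i => i), Finset.sum_range_id, Nat.choose_two_right]

/-- The energy of the adjacent exchanges at positions `l` with `i ≤ l < j`. -/
noncomputable def adjEnergy (π f : PSpace n k cnt → ℝ) (i j : ℕ) : ℝ :=
  ∑ p ∈ adjPairs n with i ≤ (p.1 : ℕ) ∧ (p.1 : ℕ) < j, edgeEnergy π (swapPos p.1 p.2) f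

lemma edgeEnergy_nonneg {Ω : Type*} [Fintype Ω] {π : Ω → ℝ} (hπ : ∀ v, 0 < π v) (τ : Ω → Ω)
    (f : Ω → ℝ) : 0 ≤ edgeEnergy π τ f :=
  Finset.sum_nonneg fun v _ => by
    have h1 := hπ v
    have h2 := hπ (τ v)
    positivity

lemma adjEnergy_succ (π f : PSpace n k cnt → ℝ) {i m : Fin n} (him : (m : ℕ) = i + 1) {j : ℕ}
    (hij : (i : ℕ) < j) :
    adjEnergy π f i j = edgeEnergy π (swapPos i m) f + adjEnergy π f m j := by
  have h1 : (i, m) ∉ (adjPairs n).filter fun p => (m : ℕ) ≤ (p.1 : ℕ) ∧ (p.1 : ℕ) < j := by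
    simp only [Finset.mem_filter, not_and]
    omega
  have h2 : ((adjPairs n).filter fun p => (i : ℕ) ≤ (p.1 : ℕ) ∧ (p.1 : ℕ) < j)
      = insert (i, m) ((adjPairs n).filter fun p => (m : ℕ) ≤ (p.1 : ℕ) ∧ (p.1 : ℕ) < j) := by
    ext ⟨p, q⟩
    simp only [adjPairs, Finset.mem_filter, Finset.mem_univ, true_and, Finset.mem_insert,
      Prod.mk.injEq, Fin.ext_iff]
    omega
  rw [adjEnergy, h2, Finset.sum_insert h1, adjEnergy]

/-- The letters strictly between positions `i` and `j` lie between the letters at `i` and `j`. -/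
def Sandwiched (i j : Fin n) (v : PSpace n k cnt) : Prop :=
  v.1 i ≤ v.1 j ∧ ∀ l, i < l → l < j → v.1 i ≤ v.1 l ∧ v.1 l ≤ v.1 j

lemma sum_sandwiched_adjacent_le {π : PSpace n k cnt → ℝ} (hπ : ∀ v, 0 < π v)
    (hmono : ∀ (p q : Fin n) (v : PSpace n k cnt), p < q → v.1 p ≤ v.1 q →
      π (swapPos p q v) ≤ π v) (f : PSpace n k cnt → ℝ) {i m : Fin n} (him : i < m)
    (v : PSpace n k cnt) (hv : v.1 i ≤ v.1 m) :
    π (swapPos i m v) * (f v - f (swapPos i m v)) ^ 2 ≤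
      2 * (π v * π (swapPos i m v) / (π v + π (swapPos i m v)) *
        (f v - f (swapPos i m v)) ^ 2) := by
  rw [← mul_assoc]
  exact mul_le_mul_of_nonneg_right
    (le_two_mul_mul_div_add (hπ _) (hπ _) (hmono i m v him hv)) (sq_nonneg _)

open scoped Classical in
/-- The energy of the exchange of two positions over sandwiched words, compared with the energy
of the adjacent exchanges along the path that carries the outer letters across one by one. -/
lemma sum_sandwiched_le {π : PSpace n k cnt → ℝ} (hπ : ∀ v, 0 < π v)
    (hmono : ∀ (p q : Fin n) (v : PSpace n k cnt), p < q → v.1 p ≤ v.1 q →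
      π (swapPos p q v) ≤ π v) (f : PSpace n k cnt → ℝ) (d : ℕ) :
    ∀ i j : Fin n, (j : ℕ) = i + d + 1 →
      ∑ v, (if Sandwiched i j v then
        π (swapPos i j v) * (f v - f (swapPos i j v)) ^ 2 else 0)
        ≤ (2 * d + 1) * (4 * adjEnergy π f i j) := by
  induction d with
  | zero =>
    intro i j hij
    have h1 : adjEnergy π f i j = edgeEnergy π (swapPos i j) f := by
      rw [adjEnergy_succ π f (m := j) (by omega) (by omega), adjEnergy,
        Finset.filter_false_of_mem (fun p _ => by omega), Finset.sum_empty, add_zero]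
    have h2 := edgeEnergy_nonneg hπ (swapPos i j) f
    rw [h1]
    refine le_trans (b := 2 * edgeEnergy π (swapPos i j) f) ?_ (by push_cast; linarith)
    rw [edgeEnergy, Finset.mul_sum]
    refine Finset.sum_le_sum fun v _ => ?_
    split_ifs with hv
    · exact sum_sandwiched_adjacent_le hπ hmono f (Fin.lt_def.2 (by omega)) v hv.1
    · have h3 := hπ v
      have h4 := hπ (swapPos i j v)
      positivity
  | succ d ih =>
    intro i j hij
    let m : Fin n := ⟨i + 1, by omega⟩
    have him : i < m := Fin.lt_def.2 (by simp [m])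
    have hmj : m < j := Fin.lt_def.2 (by simp [m]; omega)
    have hm : (m : ℕ) = i + 1 := rfl
    have ih := ih m j (by omega)
    rw [adjEnergy_succ π f hm (by omega)]
    set Q : PSpace n k cnt → ℝ := fun v =>
      2 * (π v * π (swapPos i m v) / (π v + π (swapPos i m v)) *
        (f v - f (swapPos i m v)) ^ 2) with hQ
    set Φ : PSpace n k cnt → ℝ := fun v => if Sandwiched m j v then
        π (swapPos m j v) * (f v - f (swapPos m j v)) ^ 2 else 0 with hΦ
    have hQ0 : ∀ v, 0 ≤ Q v := fun v => by
      have h3 := hπ v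
      have h4 := hπ (swapPos i m v)
      simp only [hQ]
      positivity
    have hΦ0 : ∀ v, 0 ≤ Φ v := fun v => by
      have h4 := hπ (swapPos m j v)
      simp only [hΦ]
      positivity
    have hQsum : ∑ v, Q v = 2 * edgeEnergy π (swapPos i m) f := by
      rw [edgeEnergy, Finset.mul_sum]
    have hpt : ∀ v, (if Sandwiched i j v then
        π (swapPos i j v) * (f v - f (swapPos i j v)) ^ 2 else 0) ≤
        (2 * d + 3) * (Q v + 1 / (2 * d + 1) * Φ (swapPos i m v)
          + Q (swapPos m j (swapPos i m v))) := by
      intro v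
      split_ifs with hv
      · set v₁ := swapPos i m v with hv₁
        set v₂ := swapPos m j v₁ with hv₂
        have hv₃ : swapPos i m v₂ = swapPos i j v := swapPos_conj hmj.ne (him.trans hmj).ne v
        have e1i : v₁.1 i = v.1 m := by simp [hv₁]
        have e1m : v₁.1 m = v.1 i := by simp [hv₁]
        have e1 : ∀ l, m < l → v₁.1 l = v.1 l := fun l hl => by
          rw [hv₁, swapPos_val, Equiv.swap_apply_of_ne_of_ne (him.trans hl).ne' hl.ne']
        have s0 : v.1 i ≤ v.1 m := (hv.2 m him hmj).1
        have s1 : Sandwiched m j v₁ := by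
          refine ⟨?_, fun l hl hlj => ?_⟩
          · rw [e1m, e1 j hmj]; exact hv.1
          · rw [e1m, e1 j hmj, e1 l hl]; exact hv.2 l (him.trans hl) hlj
        have s2 : v₂.1 i ≤ v₂.1 m := by
          have h1 : v₂.1 i = v₁.1 i := by
            rw [hv₂, swapPos_val, Equiv.swap_apply_of_ne_of_ne him.ne (him.trans hmj).ne]
          have h2 : v₂.1 m = v₁.1 j := by simp [hv₂]
          rw [h1, h2, e1i, e1 j hmj]
          exact (hv.2 m him hmj).2
        have q0 : π v₁ * (f v - f v₁) ^ 2 ≤ Q v :=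
          sum_sandwiched_adjacent_le hπ hmono f him v s0
        have q1 : π v₂ * (f v₁ - f v₂) ^ 2 = Φ v₁ := by simp only [hΦ, if_pos s1, hv₂]
        have q2 : π (swapPos i m v₂) * (f v₂ - f (swapPos i m v₂)) ^ 2 ≤ Q v₂ :=
          sum_sandwiched_adjacent_le hπ hmono f him v₂ s2
        have p2 : π v₂ ≤ π v₁ := hmono m j v₁ hmj s1.1
        have p3 : π (swapPos i m v₂) ≤ π v₂ := hmono i m v₂ him s2
        rw [← hv₃]
        set v₃ := swapPos i m v₂
        have c0 : π v₃ * (f v - f v₁) ^ 2 ≤ Q v :=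
          (mul_le_mul_of_nonneg_right (p3.trans p2) (sq_nonneg _)).trans q0
        have c1 : π v₃ * (f v₁ - f v₂) ^ 2 ≤ Φ v₁ :=
          (mul_le_mul_of_nonneg_right p3 (sq_nonneg _)).trans q1.le
        have cs : (f v - f v₃) ^ 2 ≤ (2 * d + 3) * ((f v - f v₁) ^ 2
            + 1 / (2 * d + 1) * (f v₁ - f v₂) ^ 2 + (f v₂ - f v₃) ^ 2) := by
          have := sq_add_add_le (L := 2 * d + 1) (by positivity) (f v - f v₁) (f v₁ - f v₂)
            (f v₂ - f v₃)
          convert! this using 2 <;> ring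
        calc π v₃ * (f v - f v₃) ^ 2 ≤ π v₃ * ((2 * d + 3) * ((f v - f v₁) ^ 2
              + 1 / (2 * d + 1) * (f v₁ - f v₂) ^ 2 + (f v₂ - f v₃) ^ 2)) :=
              mul_le_mul_of_nonneg_left cs (hπ _).le
          _ = (2 * d + 3) * (π v₃ * (f v - f v₁) ^ 2
              + 1 / (2 * d + 1) * (π v₃ * (f v₁ - f v₂) ^ 2) + π v₃ * (f v₂ - f v₃) ^ 2) := by
              ring
          _ ≤ _ := by gcongr
      · have h1 := hQ0 v
        have h2 := hΦ0 (swapPos i m v)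
        have h3 := hQ0 (swapPos m j (swapPos i m v))
        positivity
    refine (Finset.sum_le_sum fun v _ => hpt v).trans ?_
    rw [← Finset.mul_sum, Finset.sum_add_distrib, Finset.sum_add_distrib,
      ← Finset.mul_sum _ (fun v => Φ (swapPos i m v)), sum_swapPos i m Φ, sum_swapPos i m (fun w => Q (swapPos m j w)), sum_swapPos m j Q, hQsum]
    have h5 : 1 / (2 * (d : ℝ) + 1) * ∑ v, Φ v ≤ 4 * adjEnergy π f m j := by
      calc 1 / (2 * (d : ℝ) + 1) * ∑ v, Φ v
          ≤ 1 / (2 * (d : ℝ) + 1) * ((2 * d + 1) * (4 * adjEnergy π f m j)) :=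
            mul_le_mul_of_nonneg_left ih (by positivity)
        _ = _ := by field_simp
    have h6 : (0 : ℝ) ≤ 2 * d + 3 := by positivity
    push_cast
    have := mul_le_mul_of_nonneg_left (add_le_add_left h5 (4 * edgeEnergy π (swapPos i m) f)) h6
    linarith

end Words

section MixingTime

variable {Ω : Type*} [Fintype Ω] [DecidableEq Ω] {P P' : Matrix Ω Ω ℝ} {π : Ω → ℝ}

lemma mixingTime_le_of_mixed {T : ℕ}
    (hT : ∀ x : Ω, ∀ t : ℕ, T ≤ t → (1 / 2) * ∑ y : Ω, |(P ^ t) x y - π y| ≤ 1 / 4) :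
    mixingTime P π ≤ T :=
  Nat.sInf_le hT

lemma mixingTime_spec {T : ℕ}
    (hT : ∀ x : Ω, ∀ t : ℕ, T ≤ t → (1 / 2) * ∑ y : Ω, |(P ^ t) x y - π y| ≤ 1 / 4) :
    ∀ x : Ω, ∀ t : ℕ, mixingTime P π ≤ t → (1 / 2) * ∑ y : Ω, |(P ^ t) x y - π y| ≤ 1 / 4 :=
  Nat.sInf_mem (s := {T : ℕ | ∀ x : Ω, ∀ t : ℕ, T ≤ t →
    (1 / 2) * ∑ y : Ω, |(P ^ t) x y - π y| ≤ 1 / 4}) ⟨T, hT⟩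

lemma mixingTime_eq_zero_of_not_mixed
    (h : ¬ ∃ T : ℕ, ∀ x : Ω, ∀ t : ℕ, T ≤ t → (1 / 2) * ∑ y : Ω, |(P ^ t) x y - π y| ≤ 1 / 4) :
    mixingTime P π = 0 := by
  rw [mixingTime, Nat.sInf_eq_zero]
  exact Or.inr (Set.eq_empty_iff_forall_notMem.2 fun T hT => h ⟨T, hT⟩)

lemma mixingTime_zero_matrix [Nonempty Ω] (hsum : ∑ x, π x = 1) (hpos : ∀ x, 0 < π x) :
    mixingTime (0 : Matrix Ω Ω ℝ) π = 0 := by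
  refine mixingTime_eq_zero_of_not_mixed fun ⟨T, hT⟩ => ?_
  have := hT (Classical.arbitrary Ω) (T + 1) (by omega)
  simp only [zero_pow (Nat.succ_ne_zero T), Matrix.zero_apply, zero_sub, abs_neg,
    abs_of_pos (hpos _), hsum] at this
  norm_num at this

/-- Comparison of the mixing times of two reversible chains through their Dirichlet forms. -/
lemma mixingTime_comparison (hP : ReversibleChain P π) (hP' : ReversibleChain P' π)
    {p δ δ' A A' : ℝ} (hp0 : 0 < p) (hp : ∀ x, p ≤ π x) (hp1 : p ≤ 1)
    (hδ0 : 0 < δ) (hδ : ∀ x, δ ≤ P x x) (hδ0' : 0 < δ') (hδ' : ∀ x, δ' ≤ P' x x)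
    (hA0 : 0 ≤ A) (hA : ∀ f, dirichletSum P' π f ≤ A * dirichletSum P π f)
    (hA0' : 0 ≤ A') (hA' : ∀ f, dirichletSum P π f ≤ A' * dirichletSum P' π f) :
    (mixingTime P π : ℝ) ≤ (4 * A / δ * Real.log (4 / p) + 1) * mixingTime P' π := by
  have hlog : 0 ≤ Real.log (4 / p) := Real.log_nonneg (by rw [le_div_iff₀ hp0]; linarith)
  by_cases hne : ∃ T : ℕ, ∀ x : Ω, ∀ t : ℕ, T ≤ t →
      (1 / 2) * ∑ y : Ω, |(P ^ t) x y - π y| ≤ 1 / 4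
  swap
  · rw [mixingTime_eq_zero_of_not_mixed hne]
    push_cast
    positivity
  obtain ⟨S, hS⟩ := hne
  have hP'mix := hP'.mixed_of_poincare (K := 2 * S * A') hp hp0 hδ' hδ0' (by positivity)
    (fun f hf => (hP.sqNorm_le_of_mixed hS hf).trans (by
      rw [mul_assoc (2 * (S : ℝ))]
      exact mul_le_mul_of_nonneg_left (hA' f) (by positivity)))
  have hT := mixingTime_spec (P := P') (π := π) (T := ⌈2 * (2 * S * A') / δ' * Real.log (4 / p)⌉₊)
    (fun x t ht => hP'mix t (Nat.ceil_le.1 ht) x)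
  set T := mixingTime P' π
  have hPmix := hP.mixed_of_poincare (K := 2 * T * A) hp hp0 hδ hδ0 (by positivity)
    (fun f hf => (hP'.sqNorm_le_of_mixed hT hf).trans (by
      rw [mul_assoc (2 * (T : ℝ))]
      exact mul_le_mul_of_nonneg_left (hA f) (by positivity)))
  have hle := mixingTime_le_of_mixed (P := P) (π := π)
    (T := ⌈2 * (2 * T * A) / δ * Real.log (4 / p)⌉₊)
    (fun x t ht => hPmix t (Nat.ceil_le.1 ht) x)
  have hle' : (mixingTime P π : ℝ) ≤ (⌈2 * (2 * T * A) / δ * Real.log (4 / p)⌉₊ : ℝ) := by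
    exact_mod_cast hle
  refine hle'.trans ?_
  rcases Nat.eq_zero_or_pos T with h0 | hpos
  · simp [h0]
  · have h1 : (1 : ℝ) ≤ T := by exact_mod_cast hpos
    have h2 := (Nat.ceil_lt_add_one (a := 2 * (2 * T * A) / δ * Real.log (4 / p))
      (by positivity)).le
    have h3 : 2 * (2 * T * A) / δ * Real.log (4 / p) = 4 * A / δ * Real.log (4 / p) * T := by ring
    rw [h3] at h2 ⊢
    linarith

end MixingTime

section Weights

variable {n k : ℕ} {cnt : Fin k → ℕ} {s : Fin k → ℝ}

lemma partW_pos (hs : ∀ l, 0 < s l) (v : PSpace n k cnt) : 0 < partW n k cnt s v :=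
  Finset.prod_pos fun _ _ => pow_pos (hs _) _

lemma partW_swapPos {i j : Fin n} (hij : i < j) (v : PSpace n k cnt) :
    partW n k cnt s (swapPos i j v) * s (v.1 j) ^ ((j : ℕ) - i)
      = partW n k cnt s v * s (v.1 i) ^ ((j : ℕ) - i) := by
  have hj : j ∈ Finset.univ.erase i := by simp [hij.ne']
  have split : ∀ u : PSpace n k cnt, partW n k cnt s u = s (u.1 i) ^ ((i : ℕ) + 1) *
      (s (u.1 j) ^ ((j : ℕ) + 1) *
        ∏ x ∈ (Finset.univ.erase i).erase j, s (u.1 x) ^ ((x : ℕ) + 1)) := by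
    intro u
    rw [Finset.mul_prod_erase _ (fun x : Fin n => s (u.1 x) ^ ((x : ℕ) + 1)) hj,
      Finset.mul_prod_erase _ (fun x : Fin n => s (u.1 x) ^ ((x : ℕ) + 1)) (Finset.mem_univ i),
      partW]
  have hrest : ∏ x ∈ (Finset.univ.erase i).erase j, s ((swapPos i j v).1 x) ^ ((x : ℕ) + 1)
      = ∏ x ∈ (Finset.univ.erase i).erase j, s (v.1 x) ^ ((x : ℕ) + 1) := by
    refine Finset.prod_congr rfl fun x hx => ?_
    simp only [Finset.mem_erase] at hx
    rw [swapPos_val, Equiv.swap_apply_of_ne_of_ne hx.2.1 hx.1]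
  rw [split, split, hrest, swapPos_val, swapPos_val, Equiv.swap_apply_left,
    Equiv.swap_apply_right]
  obtain ⟨d, hd⟩ : ∃ d : ℕ, (j : ℕ) = i + d := ⟨j - i, by have := Fin.lt_def.1 hij; omega⟩
  rw [hd, Nat.add_sub_cancel_left]
  ring

lemma partPi_swapPos {i j : Fin n} (hij : i < j) (v : PSpace n k cnt) :
    partPi n k cnt s (swapPos i j v) * s (v.1 j) ^ ((j : ℕ) - i)
      = partPi n k cnt s v * s (v.1 i) ^ ((j : ℕ) - i) := by
  rw [partPi, partPi, div_mul_eq_mul_div, partW_swapPos hij, div_mul_eq_mul_div]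

variable [Nonempty (PSpace n k cnt)]

lemma sum_partW_pos (hs : ∀ l, 0 < s l) : 0 < ∑ u : PSpace n k cnt, partW n k cnt s u :=
  Finset.sum_pos (fun u _ => partW_pos hs u) Finset.univ_nonempty

lemma partPi_pos (hs : ∀ l, 0 < s l) (v : PSpace n k cnt) : 0 < partPi n k cnt s v :=
  div_pos (partW_pos hs v) (sum_partW_pos hs)

lemma sum_partPi (hs : ∀ l, 0 < s l) : ∑ v, partPi n k cnt s v = 1 := by
  simp only [partPi]
  rw [← Finset.sum_div, div_self (sum_partW_pos hs).ne']

lemma partPi_swapPos_le (hs : ∀ l, 0 < s l) (hmono : Monotone s) (i j : Fin n)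
    (v : PSpace n k cnt) (hij : i < j) (hv : v.1 i ≤ v.1 j) :
    partPi n k cnt s (swapPos i j v) ≤ partPi n k cnt s v := by
  refine le_of_mul_le_mul_right ?_ (pow_pos (hs (v.1 j)) ((j : ℕ) - i))
  rw [partPi_swapPos hij]
  exact mul_le_mul_of_nonneg_left (pow_le_pow_left₀ (hs _).le (hmono hv) _) (partPi_pos hs v).le

lemma div_add_eq_div_add {a b x y : ℝ} (ha : 0 < a) (hb : 0 < b) (hx : 0 < x) (hy : 0 < y)
    (h : a * y = b * x) : a / (a + b) = x / (x + y) := by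
  rw [div_eq_div_iff (by positivity) (by positivity)]
  linear_combination h

lemma partP_eq_heatBath (hs : ∀ l, 0 < s l) (hn : 1 ≤ n) :
    partP n k cnt s
      = heatBath (partPi n k cnt s) (adjPairs n) fun p => swapPos p.1 p.2 := by
  ext v u
  have hcard : (#(adjPairs n) : ℝ) = n - 1 := by
    obtain ⟨m, rfl⟩ : ∃ m, n = m + 1 := ⟨n - 1, by omega⟩
    rw [card_adjPairs]
    push_cast
    ring
  rw [partP, heatBath, hcard, adjPairs, Finset.sum_filter, Fintype.sum_prod_type]
  congr 1
  refine Finset.sum_congr rfl fun i _ => Finset.sum_congr rfl fun j _ => ?_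
  dsimp only
  by_cases h1 : (j : ℕ) = i + 1
  swap
  · rw [if_neg h1, if_neg h1]
  rw [if_pos h1, if_pos h1]
  by_cases h2 : v.1 i = v.1 j
  · rw [if_pos h2, hbKernel_eq_of_fixed (partPi_pos hs) (swapPos_eq_self h2)]
  have hlt : i < j := Fin.lt_def.2 (by omega)
  have h3 := partPi_swapPos (s := s) hlt v
  have h4 : (j : ℕ) - i = 1 := by omega
  rw [h4, pow_one, pow_one] at h3
  have h5 := div_add_eq_div_add (partPi_pos hs (swapPos i j v)) (partPi_pos hs v)
    (hs (v.1 i)) (hs (v.1 j)) h3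
  have h6 := div_add_eq_div_add (partPi_pos hs v) (partPi_pos hs (swapPos i j v))
    (hs (v.1 j)) (hs (v.1 i)) h3.symm
  rw [if_neg h2, hbKernel, ← h5, add_comm (s (v.1 i)), ← h6]
  simp only [← eq_swapPos_iff]
  rw [add_comm (partPi n k cnt s (swapPos i j v))]
  ring

lemma pow_le_partPi (hs : ∀ l, 0 < s l) {x y : ℝ} (hx : 0 < x) (hy : 0 < y) (hxy : x ≤ y)
    (hxs : ∀ l, x ≤ s l) (hys : ∀ l, s l ≤ y) (v : PSpace n k cnt) :
    (x / y) ^ (n ^ 2) / (k : ℝ) ^ n ≤ partPi n k cnt s v := by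
  set M : ℕ := ∑ i : Fin n, ((i : ℕ) + 1) with hM
  have hMn : M ≤ n ^ 2 := by
    calc M ≤ ∑ _i : Fin n, n := Finset.sum_le_sum fun i _ => Nat.succ_le_of_lt i.isLt
      _ = n ^ 2 := by simp [sq]
  have hlow : x ^ M ≤ partW n k cnt s v := by
    rw [hM, ← Finset.prod_pow_eq_pow_sum]
    exact Finset.prod_le_prod (fun _ _ => by positivity)
      fun i _ => pow_le_pow_left₀ hx.le (hxs _) _
  have hup : ∀ u, partW n k cnt s u ≤ y ^ M := fun u => by
    rw [hM, ← Finset.prod_pow_eq_pow_sum]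
    exact Finset.prod_le_prod (fun _ _ => pow_nonneg (hs _).le _)
      fun i _ => pow_le_pow_left₀ (hs _).le (hys _) _
  have hcard : (Fintype.card (PSpace n k cnt) : ℝ) ≤ (k : ℝ) ^ n := by
    have : Fintype.card (PSpace n k cnt) ≤ k ^ n := by
      simpa using Fintype.card_subtype_le
        (fun w : Fin n → Fin k => ∀ j, #(Finset.univ.filter fun i => w i = j) = cnt j)
    exact_mod_cast this
  have hsum : ∑ u : PSpace n k cnt, partW n k cnt s u ≤ (k : ℝ) ^ n * y ^ M := by
    refine (Finset.sum_le_card_nsmul _ _ _ fun u _ => hup u).trans ?_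
    rw [nsmul_eq_mul, Finset.card_univ]
    gcongr
  calc (x / y) ^ (n ^ 2) / (k : ℝ) ^ n ≤ (x / y) ^ M / (k : ℝ) ^ n := by
        have : (x / y) ^ (n ^ 2) ≤ (x / y) ^ M :=
          pow_le_pow_of_le_one (by positivity) ((div_le_one hy).2 hxy) hMn
        gcongr
    _ = x ^ M / ((k : ℝ) ^ n * y ^ M) := by rw [div_pow, div_div, mul_comm]
    _ ≤ partPi n k cnt s v := div_le_div₀ (partW_pos hs v).le hlow (sum_partW_pos hs) hsum

lemma holding_ge_of_adjacent (hs : ∀ l, 0 < s l) {x y : ℝ} (hx : 0 < x) (hy : 0 < y)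
    (hxs : ∀ l, x ≤ s l) (hys : ∀ l, s l ≤ y) {i j : Fin n} (hij : (j : ℕ) = i + 1)
    (v : PSpace n k cnt) :
    x / y / (1 + x / y) ≤ partPi n k cnt s v /
      (partPi n k cnt s v + partPi n k cnt s (swapPos i j v)) := by
  have hlt : i < j := Fin.lt_def.2 (by omega)
  have h3 := partPi_swapPos (s := s) hlt v
  have h4 : (j : ℕ) - i = 1 := by omega
  rw [h4, pow_one, pow_one] at h3
  rw [div_add_eq_div_add (partPi_pos hs v) (partPi_pos hs (swapPos i j v))
      (hs (v.1 j)) (hs (v.1 i)) h3.symm]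
  have h5 : x / y / (1 + x / y) = x / (x + y) := by field_simp; ring
  have h6 := hs (v.1 i)
  have h7 := hs (v.1 j)
  rw [h5, div_le_div_iff₀ (by positivity) (by positivity)]
  nlinarith [mul_le_mul (hxs (v.1 j)) (hys (v.1 i)) h6.le h7.le]

end Weights

section JumpHop

variable {n : ℕ} {cnt : Fin 3 → ℕ}

/-- Exchange the letters at the two positions if only letters `1` lie strictly between them. -/
def jumpMove (p : Fin n × Fin n) (v : PSpace n 3 cnt) : PSpace n 3 cnt :=
  if ∀ l, p.1 < l → l < p.2 → v.1 l = 1 then swapPos p.1 p.2 v else v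

lemma swapPos_between {i j : Fin n} (v : PSpace n 3 cnt) :
    (∀ l, i < l → l < j → (swapPos i j v).1 l = 1) ↔ ∀ l, i < l → l < j → v.1 l = 1 := by
  refine forall_congr' fun l => forall_congr' fun h1 => forall_congr' fun h2 => ?_
  rw [swapPos_val, Equiv.swap_apply_of_ne_of_ne h1.ne' h2.ne]

lemma jumpMove_involutive (p : Fin n × Fin n) :
    Function.Involutive (jumpMove p : PSpace n 3 cnt → PSpace n 3 cnt) := by
  intro v
  unfold jumpMove
  by_cases h : ∀ l, p.1 < l → l < p.2 → v.1 l = 1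
  · rw [if_pos h, if_pos ((swapPos_between v).2 h), swapPos_involutive]
  · rw [if_neg h, if_neg h]

lemma jumpMove_of_adjacent {p : Fin n × Fin n} (hp : p ∈ adjPairs n) :
    (jumpMove p : PSpace n 3 cnt → PSpace n 3 cnt) = swapPos p.1 p.2 := by
  funext v
  simp only [adjPairs, Finset.mem_filter, Finset.mem_univ, true_and] at hp
  exact if_pos fun l h1 h2 => by
    rw [Fin.lt_def] at h1 h2
    omega

lemma adjPairs_subset_ltPairs (n : ℕ) : adjPairs n ⊆ ltPairs n := fun p hp => by
  simp only [adjPairs, ltPairs, Finset.mem_filter, Finset.mem_univ, true_and, Fin.lt_def] at *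
  omega

lemma edgeEnergy_jumpMove_le {π : PSpace n 3 cnt → ℝ} (hπ : ∀ v, 0 < π v)
    (hmono : ∀ (p q : Fin n) (v : PSpace n 3 cnt), p < q → v.1 p ≤ v.1 q →
      π (swapPos p q v) ≤ π v) (f : PSpace n 3 cnt → ℝ) {p : Fin n × Fin n}
    (hp : p ∈ ltPairs n) :
    edgeEnergy π (jumpMove p) f
      ≤ 16 * n * ∑ e ∈ adjPairs n, edgeEnergy π (swapPos e.1 e.2) f := by
  classical
  obtain ⟨i, j⟩ := p
  simp only [ltPairs, Finset.mem_filter, Finset.mem_univ, true_and] at hp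
  obtain ⟨d, hd⟩ : ∃ d : ℕ, (j : ℕ) = i + d + 1 :=
    ⟨j - i - 1, by have := Fin.lt_def.1 hp; omega⟩
  set Ψ : PSpace n 3 cnt → ℝ := fun v => if Sandwiched i j v then
    π (swapPos i j v) * (f v - f (swapPos i j v)) ^ 2 else 0 with hΨ
  have hΨ0 : ∀ v, 0 ≤ Ψ v := fun v => by
    have := hπ (swapPos i j v)
    simp only [hΨ]
    positivity
  have hpath : ∑ v, Ψ v ≤ (2 * d + 1) * (4 * adjEnergy π f i j) :=
    sum_sandwiched_le hπ hmono f d i j hd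
  have hpt : ∀ v, π v * π (jumpMove (i, j) v) / (π v + π (jumpMove (i, j) v)) *
      (f v - f (jumpMove (i, j) v)) ^ 2 ≤ Ψ v + Ψ (swapPos i j v) := by
    intro v
    have h0 := add_nonneg (hΨ0 v) (hΨ0 (swapPos i j v))
    by_cases hb : ∀ l, i < l → l < j → v.1 l = 1
    swap
    · rw [jumpMove, if_neg hb]
      simpa using h0
    rw [jumpMove, if_pos hb]
    dsimp only
    rcases lt_trichotomy (v.1 i) (v.1 j) with hlt | heq | hgt
    · have hs : Sandwiched i j v := by
        refine ⟨hlt.le, fun l h1 h2 => ?_⟩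
        rw [hb l h1 h2]
        omega
      refine le_trans ?_ (le_add_of_nonneg_right (hΨ0 _))
      simp only [hΨ]
      rw [if_pos hs]
      exact mul_le_mul_of_nonneg_right (mul_div_add_le_right (hπ _) (hπ _)) (sq_nonneg _)
    · rw [swapPos_eq_self heq] at h0 ⊢
      simpa using h0
    · have hs : Sandwiched i j (swapPos i j v) := by
        refine ⟨by simpa using hgt.le, fun l h1 h2 => ?_⟩
        rw [(swapPos_between v).2 hb l h1 h2]
        simp only [swapPos_val, Equiv.swap_apply_left, Equiv.swap_apply_right]
        omega
      refine le_trans ?_ (le_add_of_nonneg_left (hΨ0 _))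
      simp only [hΨ]
      rw [if_pos hs, swapPos_involutive, ← neg_sub (f v), neg_sq, mul_comm (π v), add_comm (π v)]
      exact mul_le_mul_of_nonneg_right (mul_div_add_le_right (hπ _) (hπ _)) (sq_nonneg _)
  set Z := ∑ e ∈ adjPairs n, edgeEnergy π (swapPos e.1 e.2) f with hZ
  have hadj : adjEnergy π f i j ≤ Z :=
    Finset.sum_le_sum_of_subset_of_nonneg (Finset.filter_subset _ _)
      fun e _ _ => edgeEnergy_nonneg hπ _ _
  have hZ0 : 0 ≤ Z := Finset.sum_nonneg fun e _ => edgeEnergy_nonneg hπ _ _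
  have hadj0 : 0 ≤ adjEnergy π f i j := Finset.sum_nonneg fun e _ => edgeEnergy_nonneg hπ _ _
  have hdn : 2 * (d : ℝ) + 1 ≤ 2 * n := by
    have : 2 * d + 1 ≤ 2 * n := by have := j.isLt; omega
    exact_mod_cast this
  calc edgeEnergy π (jumpMove (i, j)) f ≤ ∑ v, (Ψ v + Ψ (swapPos i j v)) :=
        Finset.sum_le_sum fun v _ => hpt v
    _ = 2 * ∑ v, Ψ v := by
        rw [Finset.sum_add_distrib, sum_swapPos i j Ψ]
        ring
    _ ≤ 2 * ((2 * d + 1) * (4 * adjEnergy π f i j)) := by linarith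
    _ ≤ 2 * (2 * n * (4 * Z)) := by
        have h4 : 4 * adjEnergy π f i j ≤ 4 * Z := by linarith
        have h5 : (2 * (d : ℝ) + 1) * (4 * adjEnergy π f i j) ≤ 2 * n * (4 * Z) :=
          mul_le_mul hdn h4 (by linarith) (by positivity)
        linarith
    _ = 16 * n * Z := by ring

/-- The word `w` with the letters at `i` and `j` replaced. -/
def place (i j : Fin n) (α β : Fin 3) (w : Fin n → Fin 3) : Fin n → Fin 3 :=
  fun x => if x = i then α else if x = j then β else w x

lemma eq_place_self_iff {i j : Fin n} {u v : PSpace n 3 cnt} :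
    u.1 = place i j (v.1 i) (v.1 j) v.1 ↔ u = v := by
  have : place i j (v.1 i) (v.1 j) v.1 = v.1 := by
    funext x
    unfold place
    split_ifs with h1 h2
    · rw [h1]
    · rw [h2]
    · rfl
  rw [this, Subtype.ext_iff]

lemma eq_place_swap_iff {i j : Fin n} {u v : PSpace n 3 cnt} :
    u.1 = place i j (v.1 j) (v.1 i) v.1 ↔ u = swapPos i j v := by
  have : place i j (v.1 j) (v.1 i) v.1 = (swapPos i j v).1 := by
    funext x
    rw [swapPos_val, Equiv.swap_apply_def]
    unfold place
    split_ifs <;> rfl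
  rw [this, Subtype.ext_iff]

lemma hop_left_eq_place {i j : Fin n} (hij : i < j) {w : Fin n → Fin 3}
    (hb : ∀ l, i < l → l < j → w l = 1) (α : Fin 3) :
    (fun x => if x = i then α else if i ≤ x ∧ x ≤ j then 1 else w x) = place i j α 1 w := by
  funext x
  unfold place
  split_ifs with h1 h2 h3 h3
  · rfl
  · rfl
  · exact (hb x (lt_of_le_of_ne h2.1 (Ne.symm h1)) (lt_of_le_of_ne h2.2 h3)).symm
  · exact absurd ⟨h3 ▸ hij.le, h3.le⟩ h2
  · rfl

lemma hop_right_eq_place {i j : Fin n} (hij : i < j) {w : Fin n → Fin 3}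
    (hb : ∀ l, i < l → l < j → w l = 1) (α : Fin 3) :
    (fun x => if x = j then α else if i ≤ x ∧ x ≤ j then 1 else w x) = place i j 1 α w := by
  funext x
  unfold place
  by_cases h1 : x = j
  · rw [if_pos h1, if_neg (h1 ▸ hij.ne'), if_pos h1]
  by_cases h2 : x = i
  · rw [if_neg h1, if_pos ⟨h2.ge, h2 ▸ hij.le⟩, if_pos h2]
  rw [if_neg h1, if_neg h2, if_neg h1, ite_eq_right_iff]
  exact fun h3 => (hb x (lt_of_le_of_ne h3.1 (Ne.symm h2)) (lt_of_le_of_ne h3.2 h1)).symm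

lemma pow_div_one_add_pow {a b x y : ℝ} (hb : 0 < b) (hx : 0 < x) (hy : 0 < y)
    {d : ℕ} (h : b * y ^ d = a * x ^ d) :
    (y / x) ^ d / (1 + (y / x) ^ d) = a / (a + b) ∧ 1 / (1 + (y / x) ^ d) = b / (a + b) := by
  have hr : a = (y / x) ^ d * b := by
    rw [div_pow]
    field_simp
    linear_combination -h
  have hr0 : 0 < (y / x) ^ d := by positivity
  rw [hr]
  constructor <;> field_simp <;> ring

end JumpHop

lemma jumpP_eq_heatBath {a b c : ℕ} [Nonempty (PSpace (a + b + c) 3 ![a, b, c])]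
    {sA sB sC : ℝ} (hA : 0 < sA) (hB : 0 < sB) (hC : 0 < sC) :
    jumpP a b c sA sB sC = heatBath (partPi (a + b + c) 3 ![a, b, c] ![sA, sB, sC])
      (ltPairs (a + b + c)) jumpMove := by
  have hs : ∀ l : Fin 3, 0 < (![sA, sB, sC] : Fin 3 → ℝ) l := by
    intro l
    fin_cases l <;> assumption
  have hπ : ∀ v : PSpace (a + b + c) 3 ![a, b, c],
      0 < partPi (a + b + c) 3 ![a, b, c] ![sA, sB, sC] v := partPi_pos hs
  ext v u
  rw [jumpP, heatBath, card_ltPairs, ltPairs, Finset.sum_filter, Fintype.sum_prod_type]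
  congr 1
  refine Finset.sum_congr rfl fun i _ => Finset.sum_congr rfl fun j _ => ?_
  dsimp only
  by_cases hij : i < j
  swap
  · rw [if_neg hij, if_neg hij]
  rw [if_pos hij, if_pos hij]
  by_cases hb : ∀ l, i < l → l < j → v.1 l = 1
  swap
  · have hfix : jumpMove (i, j) v = v := if_neg hb
    rw [hbKernel_eq_of_fixed hπ hfix, if_neg fun h => hb h.2, if_neg, if_neg]
    · rintro (h | h)
      · exact hb fun l h1 h2 => h.2 l h1 h2.le
      · exact hb fun l h1 h2 => h.2 l h1.le h2
    · rintro (h | h)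
      · exact hb fun l h1 h2 => h.2 l h1 h2.le
      · exact hb fun l h1 h2 => h.2 l h1.le h2
  have hmove : jumpMove (i, j) v = swapPos i j v := if_pos hb
  have hle : (∀ l, i < l → l ≤ j → v.1 l = 1) ↔ v.1 j = 1 :=
    ⟨fun h => h j hij le_rfl, fun h l h1 h2 => by
      rcases h2.eq_or_lt with h3 | h3
      · rw [h3, h]
      · exact hb l h1 h3⟩
  have hge : (∀ l, i ≤ l → l < j → v.1 l = 1) ↔ v.1 i = 1 :=
    ⟨fun h => h i le_rfl hij, fun h l h1 h2 => by
      rcases h1.eq_or_lt with h3 | h3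
      · rw [← h3, h]
      · exact hb l h3 h2⟩
  have hbal := partPi_swapPos (s := ![sA, sB, sC]) hij v
  have hp := hπ v
  have hq := hπ (swapPos i j v)
  have hself := eq_place_self_iff (i := i) (j := j) (u := u) (v := v)
  have hswap := eq_place_swap_iff (i := i) (j := j) (u := u) (v := v)
  have hfold : ∀ α β : Fin 3,
      (fun x => if x = i then α else if x = j then β else v.1 x) = place i j α β v.1 :=
    fun _ _ => rfl
  simp only [hle, hge, hop_left_eq_place hij hb, hop_right_eq_place hij hb, hfold,
    and_iff_left hb]
  by_cases heq : v.1 i = v.1 j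
  · rw [hbKernel_eq_of_fixed hπ (hmove.trans (swapPos_eq_self heq)), heq]
    have h3 : ∀ x : Fin 3, x = 0 ∨ x = 1 ∨ x = 2 := by decide
    rcases h3 (v.1 j) with hj | hj | hj <;> simp [hj]
  rw [hbKernel, hmove]
  have h3 : ∀ x y : Fin 3, x ≠ y → (x = 0 ∧ y = 2) ∨ (x = 2 ∧ y = 0) ∨ (x = 0 ∧ y = 1) ∨
      (x = 1 ∧ y = 0) ∨ (x = 1 ∧ y = 2) ∨ (x = 2 ∧ y = 1) := by decide
  rcases h3 _ _ heq with ⟨hi, hj⟩ | ⟨hi, hj⟩ | ⟨hi, hj⟩ | ⟨hi, hj⟩ | ⟨hi, hj⟩ | ⟨hi, hj⟩ <;>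
    simp only [hi, hj] at hself hswap hbal ⊢
  · rw [if_pos (by decide), (pow_div_one_add_pow hq hA hC hbal).1,
      (pow_div_one_add_pow hq hA hC hbal).2]
    simp only [hself, hswap]
    ring
  · rw [if_pos (by decide), (pow_div_one_add_pow hp hA hC hbal.symm).1,
      (pow_div_one_add_pow hp hA hC hbal.symm).2]
    simp only [hself, hswap]
    ring
  · rw [if_neg (by decide), if_pos (by decide), (pow_div_one_add_pow hq hA hB hbal).1,
      (pow_div_one_add_pow hq hA hB hbal).2]
    simp only [hself, hswap]
    ring
  · rw [if_neg (by decide), if_pos (by decide), (pow_div_one_add_pow hp hA hB hbal.symm).1,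
      (pow_div_one_add_pow hp hA hB hbal.symm).2]
    simp only [hself, hswap]
    ring
  · rw [if_neg (by decide), if_neg (by decide), if_pos (by decide),
      (pow_div_one_add_pow hq hB hC hbal).1, (pow_div_one_add_pow hq hB hC hbal).2]
    simp only [hself, hswap]
    ring
  · rw [if_neg (by decide), if_neg (by decide), if_pos (by decide),
      (pow_div_one_add_pow hp hB hC hbal.symm).1, (pow_div_one_add_pow hp hB hC hbal.symm).2]
    simp only [hself, hswap]
    ring

section Comparison

variable {a b c : ℕ} {sA sB sC : ℝ}

lemma partP_dirichletSum_bounds {n : ℕ} {cnt : Fin 3 → ℕ} (hn : 2 ≤ n)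
    {π : PSpace n 3 cnt → ℝ} (hπ : ∀ v, 0 < π v)
    (hmono : ∀ (p q : Fin n) (v : PSpace n 3 cnt), p < q → v.1 p ≤ v.1 q →
      π (swapPos p q v) ≤ π v) :
    (∀ f, dirichletSum (heatBath π (ltPairs n) jumpMove) π f
      ≤ 16 * n ^ 2 * dirichletSum (heatBath π (adjPairs n) fun p => swapPos p.1 p.2) π f) ∧
    ∀ f, dirichletSum (heatBath π (adjPairs n) fun p => swapPos p.1 p.2) π f
      ≤ #(ltPairs n) / #(adjPairs n) * dirichletSum (heatBath π (ltPairs n) jumpMove) π f := by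
  have hadj : (#(adjPairs n) : ℝ) ≤ n := by
    obtain ⟨m, rfl⟩ : ∃ m, n = m + 1 := ⟨n - 1, by omega⟩
    rw [card_adjPairs]
    push_cast
    linarith
  have hadj0 : (0 : ℝ) < #(adjPairs n) := by
    obtain ⟨m, rfl⟩ : ∃ m, n = m + 1 := ⟨n - 1, by omega⟩
    rw [card_adjPairs]
    exact_mod_cast (by omega : 0 < m)
  have hlt0 : (0 : ℝ) < #(ltPairs n) := by
    rw [card_ltPairs]
    exact_mod_cast Nat.choose_pos hn
  refine ⟨fun f => ?_, fun f => ?_⟩ <;> rw [dirichletSum_heatBath, dirichletSum_heatBath]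
  · set Z := ∑ e ∈ adjPairs n, edgeEnergy π (swapPos e.1 e.2) f
    have hZ : 0 ≤ Z := Finset.sum_nonneg fun e _ => edgeEnergy_nonneg hπ _ _
    have h1 : ∑ e ∈ ltPairs n, edgeEnergy π (jumpMove e) f ≤ #(ltPairs n) * (16 * n * Z) := by
      rw [← nsmul_eq_mul]
      exact Finset.sum_le_card_nsmul _ _ _ fun e he => edgeEnergy_jumpMove_le hπ hmono f he
    calc 1 / (#(ltPairs n) : ℝ) * ∑ e ∈ ltPairs n, edgeEnergy π (jumpMove e) f
        ≤ 1 / (#(ltPairs n) : ℝ) * (#(ltPairs n) * (16 * n * Z)) := by gcongr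
      _ = 16 * n * (#(adjPairs n) * (1 / (#(adjPairs n) : ℝ) * Z)) := by field_simp
      _ ≤ 16 * n * (n * (1 / (#(adjPairs n) : ℝ) * Z)) := by gcongr
      _ = 16 * n ^ 2 * (1 / (#(adjPairs n) : ℝ) * Z) := by ring
  · have h1 : ∑ e ∈ adjPairs n, edgeEnergy π (swapPos e.1 e.2) f
        ≤ ∑ e ∈ ltPairs n, edgeEnergy π (jumpMove e) f := by
      refine (Finset.sum_le_sum fun e he => ?_).trans
        (Finset.sum_le_sum_of_subset_of_nonneg (adjPairs_subset_ltPairs n)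
          fun e _ _ => edgeEnergy_nonneg hπ _ _)
      rw [jumpMove_of_adjacent he]
    calc 1 / (#(adjPairs n) : ℝ) * ∑ e ∈ adjPairs n, edgeEnergy π (swapPos e.1 e.2) f
        ≤ 1 / (#(adjPairs n) : ℝ) * ∑ e ∈ ltPairs n, edgeEnergy π (jumpMove e) f := by gcongr
      _ = _ := by field_simp

lemma partP_mixingTime_le [Nonempty (PSpace (a + b + c) 3 ![a, b, c])] (hA : 0 < sA)
    (hAB : sA < sB) (hBC : sB < sC) (hn : 2 ≤ a + b + c) {q : ℝ} (hq : sA / sC = q) :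
    (mixingTime (partP (a + b + c) 3 ![a, b, c] ![sA, sB, sC])
        (partPi (a + b + c) 3 ![a, b, c] ![sA, sB, sC]) : ℝ) ≤
      (4 * (16 * ((a + b + c : ℕ) : ℝ) ^ 2) / (q / (1 + q)) *
          Real.log (4 / (q ^ ((a + b + c) ^ 2) / 3 ^ (a + b + c))) + 1) *
        mixingTime (jumpP a b c sA sB sC)
          (partPi (a + b + c) 3 ![a, b, c] ![sA, sB, sC]) := by
  have hB := hA.trans hAB
  have hC := hB.trans hBC
  have hs : ∀ l : Fin 3, 0 < (![sA, sB, sC] : Fin 3 → ℝ) l := by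
    intro l
    fin_cases l <;> assumption
  have hxs : ∀ l : Fin 3, sA ≤ (![sA, sB, sC] : Fin 3 → ℝ) l := by
    intro l
    fin_cases l
    exacts [le_rfl, hAB.le, (hAB.trans hBC).le]
  have hys : ∀ l : Fin 3, (![sA, sB, sC] : Fin 3 → ℝ) l ≤ sC := by
    intro l
    fin_cases l
    exacts [(hAB.trans hBC).le, hBC.le, le_rfl]
  have hsmono : Monotone (![sA, sB, sC] : Fin 3 → ℝ) := by
    rw [Fin.monotone_iff_le_succ]
    intro l
    fin_cases l
    exacts [hAB.le, hBC.le]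
  have hq0 : 0 < q := hq ▸ div_pos hA hC
  have hq1 : q ≤ 1 := hq ▸ (div_le_one hC).2 (hAB.trans hBC).le
  rw [partP_eq_heatBath hs (by omega), jumpP_eq_heatBath hA hB hC]
  have hπ : ∀ v : PSpace (a + b + c) 3 ![a, b, c],
      0 < partPi (a + b + c) 3 ![a, b, c] ![sA, sB, sC] v := partPi_pos hs
  have hsum : ∑ v, partPi (a + b + c) 3 ![a, b, c] ![sA, sB, sC] v = 1 := sum_partPi hs
  have hp := pow_le_partPi (n := a + b + c) (cnt := ![a, b, c]) hs hA hC
    (hAB.trans hBC).le hxs hys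
  have hhold := fun i j h => holding_ge_of_adjacent (n := a + b + c) (cnt := ![a, b, c]) hs hA hC
    hxs hys (i := i) (j := j) h
  have hmono := partPi_swapPos_le (n := a + b + c) (cnt := ![a, b, c]) hs hsmono
  rw [hq] at hp hhold
  push_cast at hp
  set n := a + b + c
  set π := partPi n 3 ![a, b, c] ![sA, sB, sC]
  have hadj : (adjPairs n).Nonempty := by
    obtain ⟨m, hm⟩ : ∃ m, n = m + 1 := ⟨n - 1, by omega⟩
    rw [← Finset.card_pos, hm, card_adjPairs]
    omega
  have hlt : (ltPairs n).Nonempty := hadj.mono (adjPairs_subset_ltPairs n)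
  have hpi1 : ∀ v, π v ≤ 1 := fun v =>
    hsum ▸ Finset.single_le_sum (fun u _ => (hπ u).le) (Finset.mem_univ v)
  set p := q ^ (n ^ 2) / 3 ^ n
  have hp0 : 0 < p := by positivity
  obtain ⟨h1, h2⟩ := partP_dirichletSum_bounds hn hπ hmono
  refine mixingTime_comparison (δ' := p / 2) (A' := #(ltPairs n) / #(adjPairs n))
    (heatBath_reversible hπ hsum hadj fun e _ => swapPos_involutive _ _)
    (heatBath_reversible hπ hsum hlt fun e _ => jumpMove_involutive _)
    hp0 hp ((hp _).trans (hpi1 (Classical.arbitrary _))) (by positivity)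
    (fun v => le_heatBath_self hπ hadj v fun e he => hhold _ _ ?_ v) (by positivity)
    (fun v => le_heatBath_self hπ hlt v fun e _ => ?_) (by positivity) h1 (by positivity) h2
  · simpa [adjPairs] using he
  · have h3 := hπ v
    have h4 := hπ (jumpMove e v)
    rw [div_le_div_iff₀ (by norm_num) (by positivity)]
    nlinarith [hp v, hpi1 v, hpi1 (jumpMove e v)]

end Comparison

lemma log_inv_weight_le {q : ℝ} (hq0 : 0 < q) {n : ℕ} (hn : 1 ≤ n) :
    Real.log (4 / (q ^ (n ^ 2) / 3 ^ n)) ≤ (5 - Real.log q) * (n : ℝ) ^ 2 := by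
  have hn' : (1 : ℝ) ≤ n := by exact_mod_cast hn
  have h4 : Real.log 4 ≤ 3 := by linarith [Real.log_le_sub_one_of_pos (x := 4) (by norm_num)]
  have h3 : Real.log 3 ≤ 2 := by linarith [Real.log_le_sub_one_of_pos (x := 3) (by norm_num)]
  rw [Real.log_div (by norm_num) (by positivity), Real.log_div (by positivity) (by positivity),
    Real.log_pow, Real.log_pow]
  push_cast
  nlinarith [mul_le_mul_of_nonneg_left h3 (by positivity : (0 : ℝ) ≤ n)]

/-- With strengths `0 < s_A < s_B < s_C`, `s_A/s_B < 1/2`,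
`s_B/s_C < 1/2`, the linear particle system `X₃(n)` and the Jump/Hop chain `X_t(n)`
on the same state space `Ω_{a,b,c}` (`n = a+b+c`) satisfy
`t(X₃(n)) ≤ C·n⁴·t(X_t(n))` for a constant `C` depending only on the ratios
`s_A/s_B` and `s_B/s_C`. -/
theorem particle_vs_jumpHop_mixing (qAB qBC : ℝ) :
    ∃ C : ℝ, 0 < C ∧
      ∀ (a b c : ℕ) (sA sB sC : ℝ),
        0 < sA → sA < sB → sB < sC →
        sA / sB = qAB → sB / sC = qBC → qAB < 1 / 2 → qBC < 1 / 2 →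
        (mixingTime (partP (a + b + c) 3 ![a, b, c] ![sA, sB, sC])
            (partPi (a + b + c) 3 ![a, b, c] ![sA, sB, sC]) : ℝ) ≤
          C * ((a + b + c : ℕ) : ℝ) ^ 4 *
            (mixingTime (jumpP a b c sA sB sC)
              (partPi (a + b + c) 3 ![a, b, c] ![sA, sB, sC]) : ℝ) := by
  set q := qAB * qBC with hq
  refine ⟨1 + |64 * (5 - Real.log q) / (q / (1 + q))|, by positivity, ?_⟩
  intro a b c sA sB sC hA hAB hBC h1 h2 _ _
  have hB := hA.trans hAB
  have hC := hB.trans hBC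
  have hqs : sA / sC = q := by
    rw [hq, ← h1, ← h2]
    field_simp
  have hq0 : 0 < q := hqs ▸ div_pos hA hC
  have hzero : ∀ {x K : ℝ} {m : ℕ}, x = 0 → 0 ≤ K → x ≤ K * m := fun hx hK => by
    rw [hx]
    positivity
  rcases isEmpty_or_nonempty (PSpace (a + b + c) 3 ![a, b, c]) with hE | hE
  · have : mixingTime (partP (a + b + c) 3 ![a, b, c] ![sA, sB, sC])
        (partPi (a + b + c) 3 ![a, b, c] ![sA, sB, sC]) = 0 :=
      Nat.le_zero.1 (mixingTime_le_of_mixed fun x => isEmptyElim x)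
    exact hzero (by exact_mod_cast this) (by positivity)
  by_cases hn : 2 ≤ a + b + c
  swap
  · have hs : ∀ l : Fin 3, 0 < (![sA, sB, sC] : Fin 3 → ℝ) l := by
      intro l
      fin_cases l <;> assumption
    have hP : partP (a + b + c) 3 ![a, b, c] ![sA, sB, sC] = 0 := by
      ext v u
      rw [partP, Finset.sum_eq_zero fun i _ => Finset.sum_eq_zero fun j _ => if_neg ?_, mul_zero,
        Matrix.zero_apply]
      omega
    have := mixingTime_zero_matrix (sum_partPi (n := a + b + c) (cnt := ![a, b, c]) hs)
      (partPi_pos hs)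
    rw [← hP] at this
    exact hzero (by exact_mod_cast this) (by positivity)
  refine (partP_mixingTime_le hA hAB hBC hn hqs).trans
    (mul_le_mul_of_nonneg_right ?_ (Nat.cast_nonneg _))
  have hlog := log_inv_weight_le hq0 (n := a + b + c) (by omega)
  have hn1 : (1 : ℝ) ≤ (a + b + c : ℕ) := by exact_mod_cast (by omega : 1 ≤ a + b + c)
  set n : ℝ := ((a + b + c : ℕ) : ℝ)
  have hn4 : 1 ≤ n ^ 4 := one_le_pow₀ hn1
  have h3 : 4 * (16 * n ^ 2) / (q / (1 + q)) *
      Real.log (4 / (q ^ ((a + b + c) ^ 2) / 3 ^ (a + b + c)))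
      ≤ 4 * (16 * n ^ 2) / (q / (1 + q)) * ((5 - Real.log q) * n ^ 2) := by gcongr
  have h4 : 4 * (16 * n ^ 2) / (q / (1 + q)) * ((5 - Real.log q) * n ^ 2)
      = 64 * (5 - Real.log q) / (q / (1 + q)) * n ^ 4 := by ring
  have h5 := mul_le_mul_of_nonneg_right (le_abs_self (64 * (5 - Real.log q) / (q / (1 + q))))
    (by positivity : 0 ≤ n ^ 4)
  rw [add_mul, one_mul]
  linarith
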